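/- Let G ≠ K_n be a simple connected graph on n vertices. Then ξ^ac(G) < ξ^ac(K_n). -/

import Mathlib

open Finset SimpleGraph

/-- Degree of a vertex `u`: the number of neighbors of `u`. -/
noncomputable def deg {V : Type*} [Fintype V] (G : SimpleGraph V) (u : V) : ℕ :=
  {v | G.Adj u v}.ncard

/-- `M(u)`: the product of degrees of all neighbors of `u`. -/
noncomputable def Mprod {V : Type*} [Fintype V] (G : SimpleGraph V) (u : V) : ℕ :=
  ∏ᶠ v ∈ {v | G.Adj u v}, deg G v

/-- Eccentricity of a vertex `u`: the maximum distance from `u` to any vertex. -/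
noncomputable def ecc {V : Type*} [Fintype V] (G : SimpleGraph V) (u : V) : ℕ :=
  Finset.univ.sup fun v => G.dist u v

/-- Diameter of a graph: the maximum distance between two vertices. -/
noncomputable def gdiam {V : Type*} [Fintype V] (G : SimpleGraph V) : ℕ :=
  Finset.univ.sup fun u => ecc G u

/-- The augmented eccentric connectivity index `ξ^{ac}(G) = ∑_u M(u)/ε(u)`. -/
noncomputable def xiAC {V : Type*} [Fintype V] (G : SimpleGraph V) : ℝ :=
  ∑ u : V, (Mprod G u : ℝ) / (ecc G u : ℝ)

theorem deg_eq_degree {V : Type*} [Fintype V] (G : SimpleGraph V) [DecidableRel G.Adj] (u : V) :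
    deg G u = G.degree u := by
  rw [deg, ← card_neighborFinset_eq_degree, ← Set.ncard_coe_finset, coe_neighborFinset]
  rfl

theorem Mprod_eq_prod_degree {V : Type*} [Fintype V] (G : SimpleGraph V) [DecidableRel G.Adj]
    (u : V) : Mprod G u = ∏ v ∈ G.neighborFinset u, G.degree v := by
  rw [Mprod, ← finprod_mem_coe_finset, coe_neighborFinset]
  simp only [deg_eq_degree]
  rfl

theorem Mprod_le {V : Type*} [Fintype V] [Nontrivial V] (G : SimpleGraph V) (u : V) :
    Mprod G u ≤ (Fintype.card V - 1) ^ (Fintype.card V - 1) := by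
  classical
  rw [Mprod_eq_prod_degree]
  calc ∏ v ∈ G.neighborFinset u, G.degree v
      ≤ (Fintype.card V - 1) ^ (G.neighborFinset u).card :=
        Finset.prod_le_pow_card _ _ _ fun v _ => Nat.le_sub_one_of_lt (G.degree_lt_card_verts v)
    _ ≤ (Fintype.card V - 1) ^ (Fintype.card V - 1) :=
        Nat.pow_le_pow_right (Nat.sub_pos_of_lt Fintype.one_lt_card)
          (Nat.le_sub_one_of_lt (G.degree_lt_card_verts u))

theorem Mprod_top {V : Type*} [Fintype V] (u : V) :
    Mprod (⊤ : SimpleGraph V) u = (Fintype.card V - 1) ^ (Fintype.card V - 1) := by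
  classical
  simp only [Mprod_eq_prod_degree, complete_graph_degree, Finset.prod_const,
    card_neighborFinset_eq_degree]

theorem dist_le_ecc {V : Type*} [Fintype V] (G : SimpleGraph V) (u v : V) :
    G.dist u v ≤ ecc G u :=
  Finset.le_sup (f := fun v => G.dist u v) (Finset.mem_univ v)

theorem one_le_ecc {V : Type*} [Fintype V] [Nontrivial V] {G : SimpleGraph V} (hG : G.Connected)
    (u : V) : 1 ≤ ecc G u := by
  obtain ⟨v, hv⟩ := exists_ne u
  exact (hG.pos_dist_of_ne hv.symm).trans_le (dist_le_ecc G u v)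

theorem two_le_ecc {V : Type*} [Fintype V] {G : SimpleGraph V} (hG : G.Connected) {u v : V}
    (huv : u ≠ v) (h : ¬ G.Adj u v) : 2 ≤ ecc G u := by
  have h_pos := hG.pos_dist_of_ne huv
  have h_ne : G.dist u v ≠ 1 := fun h1 => h (dist_eq_one_iff_adj.1 h1)
  have := dist_le_ecc G u v
  omega

theorem ecc_top {V : Type*} [Fintype V] [Nontrivial V] (u : V) :
    ecc (⊤ : SimpleGraph V) u = 1 := by
  refine le_antisymm (Finset.sup_le fun v _ => ?_) (one_le_ecc connected_top u)
  classical
  rw [dist_top]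
  split_ifs <;> simp

theorem xiAC_top {V : Type*} [Fintype V] [Nontrivial V] :
    xiAC (⊤ : SimpleGraph V) =
      ∑ _u : V, (((Fintype.card V - 1) ^ (Fintype.card V - 1) : ℕ) : ℝ) := by
  simp only [xiAC, Mprod_top, ecc_top, Nat.cast_one, div_one]

/-- Proposition: For a simple connected graph `G ≠ K_n` on `n` vertices,
`ξ^{ac}(G) < ξ^{ac}(K_n)`. -/
theorem xiAC_lt_complete (n : ℕ) {V : Type*} [Fintype V] (G : SimpleGraph V)
    (hG : G.Connected) (hn : Fintype.card V = n)
    (hne : G ≠ ⊤) :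
    xiAC G < xiAC (⊤ : SimpleGraph (Fin n)) := by
  obtain ⟨u, v, huv, h_adj⟩ := ne_top_iff_exists_not_adj.1 hne
  have : Nontrivial V := ⟨u, v, huv⟩
  have h_card : 1 < Fintype.card V := Fintype.one_lt_card
  have : Nontrivial (Fin n) := Fin.nontrivial_iff_two_le.2 (hn ▸ h_card)
  have h_top : xiAC (⊤ : SimpleGraph (Fin n)) = xiAC (⊤ : SimpleGraph V) := by
    simp [xiAC_top, hn]
  have h_bound (w : V) :
      (Mprod G w : ℝ) ≤ (((Fintype.card V - 1) ^ (Fintype.card V - 1) : ℕ) : ℝ) :=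
    Nat.cast_le.2 (Mprod_le G w)
  rw [h_top, xiAC_top]
  refine Finset.sum_lt_sum (fun w _ => ?_) ⟨u, Finset.mem_univ u, ?_⟩
  · exact (div_le_self (Nat.cast_nonneg _) (Nat.one_le_cast.2 (one_le_ecc hG w))).trans (h_bound w)
  · have h_ecc : (2 : ℝ) ≤ ecc G u := by exact_mod_cast two_le_ecc hG huv h_adj
    have h_pos : (0 : ℝ) < (((Fintype.card V - 1) ^ (Fintype.card V - 1) : ℕ) : ℝ) :=
      Nat.cast_pos.2 (pow_pos (Nat.sub_pos_of_lt h_card) _)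
    rw [div_lt_iff₀ (by linarith)]
    nlinarith [h_bound u]
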